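/- Let E be a standard n×n matrix. For each 1 ≤ i ≤ n let {φ_{i,ℓ}}_{ℓ∈ℕ}, {φ̃_{i,ℓ}}_{ℓ∈ℕ}, {ψ̃_{i,ℓ}}_{ℓ∈ℕ} ⊆ 𝒮(ℝ^{d_i}), set ψ_{i,0} = φ_{i,0}, ψ_{i,ℓ} = φ_{i,ℓ} − φ_{i,ℓ−1}^{(1)} for ℓ ≥ 1, and assume the one-dimensional Calderón identities φ_{i,ℓ}^{(−ℓ)} ∗ φ̃_{i,ℓ}^{(−ℓ)} = Σ_{0≤ℓ'≤ℓ} ψ_{i,ℓ'}^{(−ℓ')} ∗ ψ̃_{i,ℓ'}^{(−ℓ')} hold on ℝ^{d_i} for every ℓ ≥ 0. Define, for L = (ℓ_1,…,ℓ_n) ∈ 𝓛, Φ_L(x) = ∏_{i=1}^{n} φ_{i,ℓ_i}(x_i), Φ̃_L(x) = ∏_{i=1}^{n} φ̃_{i,ℓ_i}(x_i), Ψ_L(x) = ∏_{i∈D_L} ψ_{i,ℓ_i}(x_i)·∏_{i∉D_L} φ_{i,ℓ_i}(x_i), and Ψ̃_L(x) = ∏_{i∈D_L} ψ̃_{i,ℓ_i}(x_i)·∏_{i∉D_L}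 φ̃_{i,ℓ_i}(x_i). Then for every L ∈ 𝓛, Φ_L^{(−L)} ∗ Φ̃_L^{(−L)} = Σ_{L'∈𝓛, L'≤L} Ψ_{L'}^{(−L')} ∗ Ψ̃_{L'}^{(−L')}, where L' ≤ L means ℓ'_i ≤ ℓ_i for all i (the sum is finite). -/

import Mathlib

open MeasureTheory
open scoped Classical

noncomputable section

/-- Basic assumptions on an n×n matrix with strictly positive entries. -/
def BasicAssumptions {n : ℕ} (e : Fin n → Fin n → ℝ) : Prop :=
  (∀ i j, 0 < e i j) ∧ (∀ j, e j j = 1) ∧ (∀ j k l, e j l ≤ e j k * e k l)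

/-- A matrix is *standard*. -/
def IsStandard {n : ℕ} (e : Fin n → Fin n → ℝ) : Prop :=
  BasicAssumptions e ∧ ∀ j k, j ≠ k → 1 < e j k * e k j

/-- A marked partition of `{1,…,n}`. -/
structure MarkedPartition (n : ℕ) where
  s : ℕ
  A : Fin s → Finset (Fin n)
  k : Fin s → Fin n
  mem_k : ∀ r, k r ∈ A r
  disj : ∀ r r', r ≠ r' → Disjoint (A r) (A r')
  cover : ∀ i : Fin n, ∃ r, i ∈ A r

/-- The cone `Γ_S`. -/
def GammaS {n : ℕ} (e : Fin n → Fin n → ℝ) (S : MarkedPartition n) : Set (Fin n → ℝ) :=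
  {t | (∀ j, 0 ≤ t j) ∧
    ∀ r : Fin S.s, ∀ i ∈ S.A r, ∀ j, t j / e j i ≤ t (S.k r) / e (S.k r) i}

/-- `𝒮_E`. -/
def SE {n : ℕ} (e : Fin n → Fin n → ℝ) : Set (MarkedPartition n) :=
  {S | (interior (GammaS e S)).Nonempty}

/-- `D(S)`. -/
def DS {n : ℕ} (S : MarkedPartition n) : Finset (Fin n) :=
  Finset.image S.k Finset.univ

/-- `Γ(D)`. -/
def GammaD {n : ℕ} (e : Fin n → Fin n → ℝ) (D : Finset (Fin n)) : Set (Fin n → ℝ) :=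
  if D = ∅ then {0}
  else {t | t ≠ 0 ∧ (∀ j, 0 ≤ t j) ∧
    (∃ S : MarkedPartition n, S ∈ SE e ∧ t ∈ GammaS e S ∧ DS S = D) ∧
    (∀ T : MarkedPartition n, T ∈ SE e → t ∈ GammaS e T → D ⊆ DS T)}

/-- Maximality of `Q_L` in `𝒬_D`. -/
def QmaxIn {n : ℕ} (e : Fin n → Fin n → ℝ) (D : Finset (Fin n)) (L : Fin n → ℕ) : Prop :=
  (fun j => (L j : ℝ)) ∈ GammaD e D ∧
  ∀ j ∉ D, (fun i => ((Function.update L j (L j + 1)) i : ℝ)) ∉ GammaD e D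

/-- `𝓛(D)`. -/
def LLD {n : ℕ} (e : Fin n → Fin n → ℝ) (D : Finset (Fin n)) : Set (Fin n → ℕ) :=
  {L | QmaxIn e D L}

/-- `𝓛`. -/
def LLall {n : ℕ} (e : Fin n → Fin n → ℝ) : Set (Fin n → ℕ) :=
  ⋃ D : Finset (Fin n), LLD e D

/-- `D_L`: the unique `D` with `L ∈ Γ(D)`. -/
def DLof {n : ℕ} (e : Fin n → Fin n → ℝ) (L : Fin n → ℕ) : Finset (Fin n) :=
  if h : ∃ D : Finset (Fin n), (fun j => (L j : ℝ)) ∈ GammaD e D then h.choose else ∅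

/-- The space `ℝ^d = ℝ^{d_1} × ⋯ × ℝ^{d_n}`. -/
abbrev Xsp (n : ℕ) (d : Fin n → ℕ) : Type := (i : Fin n) → Fin (d i) → ℝ

/-- Homogeneous dimension of the `j`-th block. -/
def qdim {n : ℕ} {d : Fin n → ℕ} (lam : (i : Fin n) → Fin (d i) → ℝ)
    (j : Fin n) : ℝ :=
  ∑ h, lam j h

/-- `f^{(−s)}` on `ℝ^d`. -/
def dilR {n : ℕ} {d : Fin n → ℕ} (lam : (i : Fin n) → Fin (d i) → ℝ)
    (s : Fin n → ℝ) (F : Xsp n d → ℝ) : Xsp n d → ℝ :=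
  fun x => (2 : ℝ) ^ (∑ j, s j * qdim lam j) *
    F (fun i h => (2 : ℝ) ^ (s i * lam i h) * x i h)

/-- `g^{(p)}` on the block `ℝ^{d_i}`. -/
def dilBlock {n : ℕ} {d : Fin n → ℕ} (lam : (i : Fin n) → Fin (d i) → ℝ)
    (i : Fin n) (p : ℝ) (g : (Fin (d i) → ℝ) → ℝ) : (Fin (d i) → ℝ) → ℝ :=
  fun z => (2 : ℝ) ^ (-(p * qdim lam i)) *
    g (fun h => (2 : ℝ) ^ (-(p * lam i h)) * z h)

/-- Convolution on `ℝ^d`. -/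
def convX {n : ℕ} {d : Fin n → ℕ} (f g : Xsp n d → ℝ) : Xsp n d → ℝ :=
  fun x => ∫ y, f y * g (x - y)

/-- Convolution on the block `ℝ^{d_i}`. -/
def convB {n : ℕ} {d : Fin n → ℕ} (i : Fin n)
    (f g : (Fin (d i) → ℝ) → ℝ) : (Fin (d i) → ℝ) → ℝ :=
  fun z => ∫ w, f w * g (z - w)

/-- `ψ_{i,0} = φ_{i,0}`, `ψ_{i,ℓ} = φ_{i,ℓ} − φ_{i,ℓ−1}^{(1)}`. -/
def psiF {n : ℕ} {d : Fin n → ℕ} (lam : (i : Fin n) → Fin (d i) → ℝ)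
    (φ : (i : Fin n) → ℕ → SchwartzMap (Fin (d i) → ℝ) ℝ) (i : Fin n) :
    ℕ → (Fin (d i) → ℝ) → ℝ
  | 0 => ⇑(φ i 0)
  | (ℓ + 1) => ⇑(φ i (ℓ + 1)) - dilBlock lam i 1 ⇑(φ i ℓ)

/-- The tensor product `Φ_L = ⊗_i φ_{i,ℓ_i}`. -/
def PhiT {n : ℕ} {d : Fin n → ℕ}
    (φ : (i : Fin n) → ℕ → SchwartzMap (Fin (d i) → ℝ) ℝ)
    (L : Fin n → ℕ) : Xsp n d → ℝ :=
  fun x => ∏ i, φ i (L i) (x i)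

/-- The tensor product `Ψ_L` (with `ψ` factors on `D_L`, `φ` factors off). -/
def PsiT {n : ℕ} {d : Fin n → ℕ} (e : Fin n → Fin n → ℝ)
    (lam : (i : Fin n) → Fin (d i) → ℝ)
    (φ : (i : Fin n) → ℕ → SchwartzMap (Fin (d i) → ℝ) ℝ)
    (L : Fin n → ℕ) : Xsp n d → ℝ :=
  fun x => ∏ i, (if i ∈ DLof e L then psiF lam φ i (L i) (x i) else φ i (L i) (x i))

/-- The tensor product `Ψ̃_L` built from given families `ψ̃, φ̃`. -/
def PsiTl {n : ℕ} {d : Fin n → ℕ} (e : Fin n → Fin n → ℝ)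
    (ψt φt : (i : Fin n) → ℕ → SchwartzMap (Fin (d i) → ℝ) ℝ)
    (L : Fin n → ℕ) : Xsp n d → ℝ :=
  fun x => ∏ i, (if i ∈ DLof e L then ψt i (L i) (x i) else φt i (L i) (x i))

/-- Strictly dominant indices. -/
def SDset {n : ℕ} (e : Fin n → Fin n → ℝ) (t : Fin n → ℝ) : Finset (Fin n) :=
  Finset.univ.filter (fun k => 0 < t k ∧ ∀ j, j ≠ k → t j < e j k * t k)

lemma mem_SDset {n : ℕ} {e : Fin n → Fin n → ℝ} {t : Fin n → ℝ} {k : Fin n} :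
    k ∈ SDset e t ↔ 0 < t k ∧ ∀ j, j ≠ k → t j < e j k * t k := by
  simp [SDset]

lemma attain {n : ℕ} {e : Fin n → Fin n → ℝ} (hE : IsStandard e) {t : Fin n → ℝ}
    (ht : ∀ j, 0 ≤ t j) (ht0 : t ≠ 0) (i : Fin n) :
    ∃ k ∈ SDset e t, ∀ j, t j / e j i ≤ t k / e k i := by
  obtain ⟨⟨hpos, hone, htri⟩, hstd⟩ := hE
  obtain ⟨j0, hj0⟩ : ∃ j, t j ≠ 0 := by
    by_contra! h
    exact ht0 (funext h)
  have hj0' : 0 < t j0 := lt_of_le_of_ne (ht j0) (Ne.symm hj0)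
  obtain ⟨k0, -, hk0⟩ := Finset.exists_max_image Finset.univ (fun k => t k / e k i) ⟨i, Finset.mem_univ i⟩
  obtain ⟨k, hk, hkmax⟩ := Finset.exists_max_image
    (Finset.univ.filter (fun k => ∀ j, t j / e j i ≤ t k / e k i))
    (fun k => ∑ l, t k / e k l) ⟨k0, by simpa using fun j => hk0 j (Finset.mem_univ j)⟩
  have hk' : ∀ j, t j / e j i ≤ t k / e k i := by simpa using hk
  have htk : 0 < t k := by
    have h1 : 0 < t k / e k i := lt_of_lt_of_le (div_pos hj0' (hpos _ _)) (hk' j0)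
    have := mul_pos h1 (hpos k i)
    rwa [div_mul_cancel₀ _ (hpos k i).ne'] at this
  refine ⟨k, ?_, hk'⟩
  rw [mem_SDset]
  refine ⟨htk, ?_⟩
  by_contra! hcon
  obtain ⟨j, hjk, hj⟩ := hcon
  have hle : ∀ l, t k / e k l ≤ t j / e j l := by
    intro l
    rw [div_le_div_iff₀ (hpos _ _) (hpos _ _)]
    calc t k * e j l ≤ t k * (e j k * e k l) := by gcongr; exact htri _ _ _
      _ = (e j k * t k) * e k l := by ring
      _ ≤ t j * e k l := by have := (hpos k l).le; gcongr
  have hlt : t k / e k j < t j / e j j := by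
    rw [hone, div_one, div_lt_iff₀ (hpos _ _)]
    calc t k = t k * 1 := by ring
      _ < t k * (e j k * e k j) := by gcongr; exact hstd j k hjk
      _ = (e j k * t k) * e k j := by ring
      _ ≤ t j * e k j := by have := (hpos k j).le; gcongr
  have h2 := hkmax j (by simpa using fun l => (hk' l).trans (hle i))
  have h3 : ∑ l, t k / e k l < ∑ l, t j / e j l :=
    Finset.sum_lt_sum (fun l _ => hle l) ⟨j, Finset.mem_univ j, hlt⟩
  exact absurd h2 (not_le.mpr h3)

lemma SDset_subset {n : ℕ} {e : Fin n → Fin n → ℝ} (hE : IsStandard e) {t : Fin n → ℝ}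
    (S : MarkedPartition n) (hS : t ∈ GammaS e S) : SDset e t ⊆ DS S := by
  obtain ⟨⟨hpos, hone, htri⟩, hstd⟩ := hE
  intro k hk
  rw [mem_SDset] at hk
  obtain ⟨r, hr⟩ := S.cover k
  have h := hS.2 r k hr k
  rw [hone, div_one, le_div_iff₀ (hpos _ _)] at h
  by_cases hkr : S.k r = k
  · simp only [DS, Finset.mem_image]
    exact ⟨r, Finset.mem_univ _, hkr⟩
  · have := hk.2 _ hkr
    linarith [mul_comm (t k) (e (S.k r) k)]

open Filter Topology in
lemma perturb (a b p q c c' : ℝ) (hb : 0 < b) (hab : a ≤ b) (hc : a = b → c < c') :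
    ∀ᶠ ε in 𝓝[>] (0:ℝ), a * (1 + ε * c) + ε ^ 2 * p < b * (1 + ε * c') + ε ^ 2 * q := by
  rcases hab.lt_or_eq with h | h
  · have h1 : Tendsto (fun ε : ℝ => a * (1 + ε * c) + ε ^ 2 * p) (𝓝 0)
        (𝓝 (a * (1 + 0 * c) + 0 ^ 2 * p)) := by
      apply Continuous.tendsto; fun_prop
    have h2 : Tendsto (fun ε : ℝ => b * (1 + ε * c') + ε ^ 2 * q) (𝓝 0)
        (𝓝 (b * (1 + 0 * c') + 0 ^ 2 * q)) := by
      apply Continuous.tendsto; fun_prop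
    exact (h1.eventually_lt h2 (by simpa using h)).filter_mono nhdsWithin_le_nhds
  · have h1 : Tendsto (fun ε : ℝ => b * c + ε * p) (𝓝 0) (𝓝 (b * c + 0 * p)) := by
      apply Continuous.tendsto; fun_prop
    have h2 : Tendsto (fun ε : ℝ => b * c' + ε * q) (𝓝 0) (𝓝 (b * c' + 0 * q)) := by
      apply Continuous.tendsto; fun_prop
    have h3 := (h1.eventually_lt h2 (by
      have := mul_lt_mul_of_pos_left (hc h) hb
      simpa using this)).filter_mono (nhdsWithin_le_nhds (s := Set.Ioi 0))
    filter_upwards [h3, self_mem_nhdsWithin] with ε h4 h5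
    have h5' : (0:ℝ) < ε := h5
    have := mul_lt_mul_of_pos_left h4 h5'
    rw [h]
    nlinarith

open Filter Topology in
lemma exists_SE {n : ℕ} {e : Fin n → Fin n → ℝ} (hE : IsStandard e) {t : Fin n → ℝ}
    (ht : ∀ j, 0 ≤ t j) (ht0 : t ≠ 0) :
    ∃ S : MarkedPartition n, S ∈ SE e ∧ t ∈ GammaS e S ∧ DS S = SDset e t := by
  have hE' := hE
  obtain ⟨⟨hpos, hone, htri⟩, hstd⟩ := hE'
  have hκ : ∀ i, ∃ k ∈ SDset e t, (∀ j, t j / e j i ≤ t k / e k i) ∧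
      ∀ j ∈ SDset e t, t j / e j i = t k / e k i → j ≤ k := by
    intro i
    obtain ⟨k0, hk0, hk0'⟩ := attain hE ht ht0 i
    obtain ⟨k, hk, hkm⟩ := Finset.exists_max_image
      ((SDset e t).filter (fun k => ∀ j, t j / e j i ≤ t k / e k i)) id
      ⟨k0, by simpa using ⟨hk0, hk0'⟩⟩
    rw [Finset.mem_filter] at hk
    refine ⟨k, hk.1, hk.2, fun j hj hjk => hkm j ?_⟩
    rw [Finset.mem_filter]
    exact ⟨hj, fun l => hjk ▸ hk.2 l⟩
  choose κ κmem κmax κtop using hκ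
  have κself : ∀ k ∈ SDset e t, κ k = k := by
    intro k hk
    by_contra hne
    have h := κmax k k
    rw [hone, div_one, le_div_iff₀ (hpos _ _)] at h
    have := (mem_SDset.1 hk).2 _ hne
    linarith [mul_comm (t k) (e (κ k) k)]
  let F := (SDset e t).equivFin
  let S : MarkedPartition n :=
    { s := (SDset e t).card
      A := fun r => Finset.univ.filter (fun i => κ i = (F.symm r : Fin n))
      k := fun r => (F.symm r : Fin n)
      mem_k := fun r => by simpa using κself _ (F.symm r).2
      disj := by
        intro r r' hrr
        rw [Finset.disjoint_left]
        intro i hi hi'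
        simp only [Finset.mem_filter, Finset.mem_univ, true_and] at hi hi'
        exact hrr (F.symm.injective (Subtype.ext (hi.symm.trans hi')))
      cover := fun i => ⟨F ⟨κ i, κmem i⟩, by simp⟩ }
  have hDS : DS S = SDset e t := by
    ext k
    simp only [DS, Finset.mem_image, Finset.mem_univ, true_and]
    constructor
    · rintro ⟨r, rfl⟩
      exact (F.symm r).2
    · intro hk
      exact ⟨F ⟨k, hk⟩, by simp [S]⟩
  refine ⟨S, ?_, ⟨ht, ?_⟩, hDS⟩
  · let U : Set (Fin n → ℝ) := {u | (∀ j, 0 < u j) ∧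
      ∀ i j, j ≠ κ i → u j / e j i < u (κ i) / e (κ i) i}
    have hU : IsOpen U := by
      have : U = (⋂ j, {u : Fin n → ℝ | 0 < u j}) ∩
          ⋂ i, ⋂ j, {u : Fin n → ℝ | j ≠ κ i → u j / e j i < u (κ i) / e (κ i) i} := by
        ext u; simp [U]
      rw [this]
      refine IsOpen.inter (isOpen_iInter_of_finite fun j => isOpen_lt (by fun_prop) (by fun_prop))
        (isOpen_iInter_of_finite fun i => isOpen_iInter_of_finite fun j => ?_)
      by_cases hj : j = κ i
      · simp [hj]
      · simp only [ne_eq, hj, not_false_eq_true, forall_true_left]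
        exact isOpen_lt (by fun_prop) (by fun_prop)
    have hUsub : U ⊆ GammaS e S := by
      rintro u ⟨hu1, hu2⟩
      refine ⟨fun j => (hu1 j).le, ?_⟩
      intro r i hi j
      have hi' : κ i = S.k r := by simpa [S] using hi
      rw [← hi']
      by_cases hj : j = κ i
      · rw [hj]
      · exact (hu2 i j hj).le
    let c : Fin n → ℝ := fun j => if j ∈ SDset e t then (j.val : ℝ) + 1 else 0
    have hc0 : ∀ j, 0 ≤ c j := by intro j; simp only [c]; split_ifs <;> positivity
    have hev : ∀ᶠ ε in 𝓝[>] (0:ℝ), ∀ i j, j ≠ κ i →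
        t j / e j i * (1 + ε * c j) + ε ^ 2 * (1 / e j i) <
        t (κ i) / e (κ i) i * (1 + ε * c (κ i)) + ε ^ 2 * (1 / e (κ i) i) := by
      rw [eventually_all]; intro i
      rw [eventually_all]; intro j
      by_cases hj : j = κ i
      · simp [hj]
      · simp only [ne_eq, hj, not_false_eq_true, forall_true_left]
        apply perturb
        · exact div_pos (mem_SDset.1 (κmem i)).1 (hpos _ _)
        · exact κmax i j
        · intro heq
          simp only [c, κmem i, if_true]
          split_ifs with hjS
          · have h1 := lt_of_le_of_ne (κtop i j hjS heq) hj
            have h2 : (j.val : ℝ) < (κ i).val := by exact_mod_cast h1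
            linarith
          · positivity
    obtain ⟨ε, hε, hε0⟩ := (hev.and self_mem_nhdsWithin).exists
    have hε0' : (0:ℝ) < ε := hε0
    refine ⟨fun j => t j * (1 + ε * c j) + ε ^ 2, ?_⟩
    refine interior_maximal hUsub hU ⟨fun j => ?_, fun i j hj => ?_⟩
    · have := ht j; have := hc0 j; positivity
    · have := hε i j hj
      convert this using 1 <;> ring
  · intro r i hi j
    have hi' : κ i = S.k r := by simpa [S] using hi
    rw [← hi']
    exact κmax i j

lemma SDset_nonempty {n : ℕ} {e : Fin n → Fin n → ℝ} (hE : IsStandard e) {t : Fin n → ℝ}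
    (ht : ∀ j, 0 ≤ t j) (ht0 : t ≠ 0) : SDset e t ≠ ∅ := by
  obtain ⟨j0, hj0⟩ : ∃ j, t j ≠ 0 := by
    by_contra! h
    exact ht0 (funext h)
  obtain ⟨k, hk, -⟩ := attain hE ht ht0 j0
  exact Finset.ne_empty_of_mem hk

lemma mem_GammaD {n : ℕ} {e : Fin n → Fin n → ℝ} (hE : IsStandard e) {t : Fin n → ℝ}
    (ht : ∀ j, 0 ≤ t j) (D : Finset (Fin n)) : t ∈ GammaD e D ↔ SDset e t = D := by
  by_cases ht0 : t = 0
  · have h0 : SDset e t = ∅ := by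
      ext k; simp [mem_SDset, ht0]
    rw [h0]
    unfold GammaD
    split_ifs with hD
    · simp [ht0, hD]
    · simp only [Set.mem_ofPred_eq]
      constructor
      · intro h; exact absurd ht0 h.1
      · intro h; exact absurd h.symm hD
  · have hne := SDset_nonempty hE ht ht0
    obtain ⟨S0, hS0, htS0, hD0⟩ := exists_SE hE ht ht0
    unfold GammaD
    split_ifs with hD
    · simp only [Set.mem_singleton_iff, ht0, false_iff, hD]
      exact hne
    · simp only [Set.mem_ofPred_eq]
      constructor
      · rintro ⟨-, -, ⟨S, hS, htS, rfl⟩, hmin⟩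
        exact (SDset_subset hE S htS).antisymm (hD0 ▸ hmin S0 hS0 htS0)
      · rintro rfl
        exact ⟨ht0, ht, ⟨S0, hS0, htS0, hD0⟩, fun T _ htT => SDset_subset hE T htT⟩

lemma SD_off {n : ℕ} {e : Fin n → Fin n → ℝ} (hE : IsStandard e) {t : Fin n → ℝ}
    (ht : ∀ j, 0 ≤ t j) {j : Fin n} :
    t j = 0 ∨ ∃ k ∈ SDset e t, e k j * t j ≤ t k := by
  by_cases h : t j = 0
  · exact Or.inl h
  · right
    have ht0 : t ≠ 0 := fun h0 => h (by rw [h0]; rfl)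
    obtain ⟨k, hk, hk'⟩ := attain hE ht ht0 j
    refine ⟨k, hk, ?_⟩
    have := hk' j
    rw [hE.1.2.1, div_one, le_div_iff₀ (hE.1.1 _ _)] at this
    linarith [mul_comm (t j) (e k j)]

lemma SD_box {n : ℕ} {e : Fin n → Fin n → ℝ} (hE : IsStandard e) {t s : Fin n → ℝ}
    (hst : ∀ k ∈ SDset e t, s k = t k)
    (hoff : ∀ j ∉ SDset e t, s j = 0 ∨ ∃ k ∈ SDset e t, e k j * s j ≤ t k) :
    SDset e s = SDset e t := by
  obtain ⟨⟨hpos, hone, htri⟩, hstd⟩ := hE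
  ext k
  constructor
  · intro hk
    by_contra hkt
    obtain ⟨h1, h2⟩ := mem_SDset.1 hk
    rcases hoff k hkt with h0 | ⟨l, hl, hl'⟩
    · linarith
    · have hlk : l ≠ k := fun h => hkt (h ▸ hl)
      have := h2 l hlk
      rw [hst l hl] at this
      linarith
  · intro hk
    obtain ⟨h1, h2⟩ := mem_SDset.1 hk
    rw [mem_SDset, hst k hk]
    refine ⟨h1, fun j hj => ?_⟩
    by_cases hjt : j ∈ SDset e t
    · rw [hst j hjt]; exact h2 j hj
    · rcases hoff j hjt with h0 | ⟨l, hl, hl'⟩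
      · rw [h0]; exact mul_pos (hpos _ _) h1
      · have key : t l < e l j * (e j k * t k) := by
          by_cases hlk : l = k
          · subst hlk
            have := mul_lt_mul_of_pos_right (hstd l j (Ne.symm hj)) h1
            linarith [mul_assoc (e l j) (e j l) (t l)]
          · have h3 := h2 l hlk
            have h4 := mul_le_mul_of_nonneg_right (htri l j k) h1.le
            linarith [mul_assoc (e l j) (e j k) (t k)]
        exact lt_of_mul_lt_mul_left (hl'.trans_lt key) (hpos l j).le

/-- Strictly dominant set of an integer vector. -/
def nSD {n : ℕ} (e : Fin n → Fin n → ℝ) (L : Fin n → ℕ) : Finset (Fin n) :=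
  SDset e (fun j => (L j : ℝ))

lemma mem_GammaD_nat {n : ℕ} {e : Fin n → Fin n → ℝ} (hE : IsStandard e) (L : Fin n → ℕ)
    (D : Finset (Fin n)) : (fun j => (L j : ℝ)) ∈ GammaD e D ↔ nSD e L = D :=
  mem_GammaD hE (fun j => Nat.cast_nonneg _) D

lemma DLof_eq {n : ℕ} {e : Fin n → Fin n → ℝ} (hE : IsStandard e) (L : Fin n → ℕ) :
    DLof e L = nSD e L := by
  have h : ∃ D : Finset (Fin n), (fun j => (L j : ℝ)) ∈ GammaD e D :=
    ⟨nSD e L, (mem_GammaD_nat hE L _).2 rfl⟩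
  unfold DLof
  rw [dif_pos h]
  exact ((mem_GammaD_nat hE L _).1 h.choose_spec).symm

lemma nSD_off {n : ℕ} {e : Fin n → Fin n → ℝ} (hE : IsStandard e) (L : Fin n → ℕ) (j : Fin n) :
    L j = 0 ∨ ∃ k ∈ nSD e L, e k j * (L j : ℝ) ≤ (L k : ℝ) := by
  rcases SD_off hE (t := fun j => (L j : ℝ)) (fun j => Nat.cast_nonneg _) (j := j) with h | h
  · left; exact_mod_cast h
  · exact Or.inr h

lemma nSD_box {n : ℕ} {e : Fin n → Fin n → ℝ} (hE : IsStandard e) {L M : Fin n → ℕ}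
    (hst : ∀ k ∈ nSD e L, M k = L k)
    (hoff : ∀ j ∉ nSD e L, M j = 0 ∨ ∃ k ∈ nSD e L, e k j * (M j : ℝ) ≤ (L k : ℝ)) :
    nSD e M = nSD e L := by
  apply SD_box hE
  · intro k hk; exact congrArg Nat.cast (hst k hk)
  · intro j hj
    rcases hoff j hj with h | h
    · left; simp [h]
    · exact Or.inr h

lemma LL_iff {n : ℕ} {e : Fin n → Fin n → ℝ} (hE : IsStandard e) (L : Fin n → ℕ) :
    L ∈ LLall e ↔ ∀ j ∉ nSD e L, ∀ k ∈ nSD e L, (L k : ℝ) < e k j * ((L j : ℝ) + 1) := by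
  simp only [LLall, Set.mem_iUnion]
  constructor
  · rintro ⟨D, hD⟩ j hj k hk
    obtain ⟨h1, h2⟩ : QmaxIn e D L := hD
    rw [mem_GammaD_nat hE] at h1
    subst h1
    by_contra! hcon
    refine h2 j hj ?_
    rw [mem_GammaD_nat hE]
    apply nSD_box hE
    · intro l hl
      have : l ≠ j := fun h => hj (h ▸ hl)
      simp [this]
    · intro l hl
      by_cases hlj : l = j
      · subst hlj
        exact Or.inr ⟨k, hk, by simpa using hcon⟩
      · simpa [hlj] using nSD_off hE L l
  · intro h
    refine ⟨nSD e L, ?_⟩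
    show QmaxIn e (nSD e L) L
    refine ⟨(mem_GammaD_nat hE L _).2 rfl, fun j hj hmem => ?_⟩
    rw [mem_GammaD_nat hE] at hmem
    rcases nSD_off hE (Function.update L j (L j + 1)) j with h0 | ⟨k, hk, hk'⟩
    · simp at h0
    · rw [hmem] at hk
      have hkj : k ≠ j := fun h => hj (h ▸ hk)
      have := h j hj k hk
      simp [hkj] at hk'
      linarith

/-- The maximal vector attached to `M`. -/
def Hmap {n : ℕ} (e : Fin n → Fin n → ℝ) (M : Fin n → ℕ) : Fin n → ℕ :=
  fun j => if j ∈ nSD e M then M j else (nSD e M).sup (fun k => ⌊(M k : ℝ) / e k j⌋₊)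

lemma nSD_Hmap {n : ℕ} {e : Fin n → Fin n → ℝ} (hE : IsStandard e) (M : Fin n → ℕ) :
    nSD e (Hmap e M) = nSD e M := by
  apply nSD_box hE
  · intro k hk; simp [Hmap, hk]
  · intro j hj
    simp only [Hmap, hj, if_false]
    rcases (nSD e M).eq_empty_or_nonempty with h | h
    · left; simp [h]
    · right
      obtain ⟨k, hk, hk'⟩ := Finset.exists_mem_eq_sup _ h (fun k => ⌊(M k : ℝ) / e k j⌋₊)
      refine ⟨k, hk, ?_⟩
      rw [hk']
      have hp := hE.1.1 k j
      have := Nat.floor_le (a := (M k : ℝ) / e k j) (by positivity)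
      rw [le_div_iff₀ hp] at this
      linarith [mul_comm (e k j) (⌊(M k : ℝ) / e k j⌋₊ : ℝ)]

lemma Hmap_mem {n : ℕ} {e : Fin n → Fin n → ℝ} (hE : IsStandard e) (M : Fin n → ℕ) :
    Hmap e M ∈ LLall e := by
  rw [LL_iff hE, nSD_Hmap hE]
  intro j hj k hk
  have hp := hE.1.1 k j
  have h1 : ⌊(M k : ℝ) / e k j⌋₊ ≤ (nSD e M).sup (fun k => ⌊(M k : ℝ) / e k j⌋₊) :=
    Finset.le_sup (f := fun k => ⌊(M k : ℝ) / e k j⌋₊) hk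
  have h2 := Nat.lt_floor_add_one ((M k : ℝ) / e k j)
  have h3 : (⌊(M k : ℝ) / e k j⌋₊ : ℝ) ≤
    ((nSD e M).sup (fun k => ⌊(M k : ℝ) / e k j⌋₊) : ℕ) := by exact_mod_cast h1
  simp only [Hmap, hj, hk, if_false, if_true]
  rw [mul_comm, ← div_lt_iff₀ hp]
  linarith

lemma le_Hmap {n : ℕ} {e : Fin n → Fin n → ℝ} (hE : IsStandard e) (M : Fin n → ℕ) (j : Fin n) :
    M j ≤ Hmap e M j := by
  unfold Hmap
  split_ifs with hj
  · exact le_rfl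
  · rcases nSD_off hE M j with h | ⟨k, hk, hk'⟩
    · omega
    · refine le_trans ?_ (Finset.le_sup (f := fun k => ⌊(M k : ℝ) / e k j⌋₊) hk)
      apply Nat.le_floor
      rw [le_div_iff₀ (hE.1.1 k j)]
      linarith [mul_comm (e k j) (M j : ℝ)]

lemma Hmap_le {n : ℕ} {e : Fin n → Fin n → ℝ} (hE : IsStandard e) {M L : Fin n → ℕ}
    (hL : L ∈ LLall e) (hML : ∀ j, M j ≤ L j) (j : Fin n) : Hmap e M j ≤ L j := by
  unfold Hmap
  split_ifs with hj
  · exact hML j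
  · apply Finset.sup_le
    intro k hk
    have hp := hE.1.1 k j
    have hkj : k ≠ j := fun h => hj (h ▸ hk)
    have hMk : (M k : ℝ) ≤ L k := by exact_mod_cast hML k
    rw [← Nat.lt_succ_iff, Nat.floor_lt (by positivity)]
    push_cast
    by_cases hjL : j ∈ nSD e L
    · have := (mem_SDset.1 hjL).2 k hkj
      rw [div_lt_iff₀ hp]
      nlinarith
    · have hk0 : 0 < (M k : ℝ) := (mem_SDset.1 hk).1
      have hL0 : (fun j => (L j : ℝ)) ≠ 0 := by
        intro h
        have := congrFun h k
        simp only [Pi.zero_apply] at this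
        linarith
      obtain ⟨k1, hk1, hk1'⟩ := attain hE (t := fun j => (L j : ℝ)) (fun j => Nat.cast_nonneg _) hL0 j
      have h1 := (LL_iff hE L).1 hL j hjL k1 hk1
      have h2 := hk1' k
      calc (M k : ℝ) / e k j ≤ L k / e k j := by gcongr
        _ ≤ L k1 / e k1 j := h2
        _ < L j + 1 := by
          rw [div_lt_iff₀ (hE.1.1 k1 j)]; linarith [mul_comm (e k1 j) ((L j : ℝ) + 1)]

lemma Hmap_eq_iff {n : ℕ} {e : Fin n → Fin n → ℝ} (hE : IsStandard e) {M L : Fin n → ℕ}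
    (hL : L ∈ LLall e) :
    Hmap e M = L ↔ ∀ i, if i ∈ nSD e L then M i = L i else M i ≤ L i := by
  constructor
  · rintro rfl i
    rw [nSD_Hmap hE]
    split_ifs with hi
    · simp [Hmap, hi]
    · exact le_Hmap hE M i
  · intro h
    have h1 : ∀ i ∈ nSD e L, M i = L i := fun i hi => by simpa [hi] using h i
    have h2 : ∀ i ∉ nSD e L, M i ≤ L i := fun i hi => by simpa [hi] using h i
    have hSD : nSD e M = nSD e L := by
      apply nSD_box hE h1
      intro j hj
      have hj2 := h2 j hj
      rcases nSD_off hE L j with h0 | ⟨k, hk, hk'⟩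
      · left; omega
      · right
        refine ⟨k, hk, le_trans ?_ hk'⟩
        have := (hE.1.1 k j).le
        gcongr
    funext j
    by_cases hj : j ∈ nSD e L
    · simp [Hmap, hSD, hj, h1 j hj]
    · simp only [Hmap, hSD, hj, if_false]
      apply le_antisymm
      · apply Finset.sup_le
        intro k hk
        have hp := hE.1.1 k j
        rw [h1 k hk, ← Nat.lt_succ_iff, Nat.floor_lt (by positivity), div_lt_iff₀ hp]
        push_cast
        linarith [(LL_iff hE L).1 hL j hj k hk, mul_comm (e k j) ((L j : ℝ) + 1)]
      · rcases nSD_off hE L j with h0 | ⟨k, hk, hk'⟩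
        · omega
        · refine le_trans ?_ (Finset.le_sup (f := fun k => ⌊(M k : ℝ) / e k j⌋₊) hk)
          apply Nat.le_floor
          rw [le_div_iff₀ (hE.1.1 k j), h1 k hk]
          linarith [mul_comm (e k j) (L j : ℝ)]

lemma comb {n : ℕ} {e : Fin n → Fin n → ℝ} (hE : IsStandard e) {L : Fin n → ℕ}
    (hL : L ∈ LLall e) (a : Fin n → ℕ → ℝ) :
    ∏ i, ∑ m ∈ Finset.range (L i + 1), a i m =
    ∑ g : (i : Fin n) → Fin (L i + 1),
        (if (fun i => (g i : ℕ)) ∈ LLall e then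
          ∏ i, (if i ∈ nSD e (fun i => (g i : ℕ)) then a i (g i)
            else ∑ m ∈ Finset.range ((g i : ℕ) + 1), a i m)
        else 0) := by
  set B : Finset (Fin n → ℕ) := Fintype.piFinset (fun i => Finset.range (L i + 1)) with hB
  let f : (Fin n → ℕ) → ℝ := fun g => if g ∈ LLall e then
          ∏ i, (if i ∈ nSD e g then a i (g i)
            else ∑ m ∈ Finset.range (g i + 1), a i m)
        else 0
  have hR : ∑ g : (i : Fin n) → Fin (L i + 1), f (fun i => (g i : ℕ)) = ∑ g ∈ B, f g := by
    refine Finset.sum_bij (fun g _ i => (g i : ℕ)) ?_ ?_ ?_ ?_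
    · intro g _
      simp only [hB, Fintype.mem_piFinset, Finset.mem_range]
      exact fun i => (g i).2
    · intro g _ g' _ h
      funext i
      exact Fin.ext (congrFun h i)
    · intro g hg
      simp only [hB, Fintype.mem_piFinset, Finset.mem_range] at hg
      exact ⟨fun i => ⟨g i, hg i⟩, Finset.mem_univ _, rfl⟩
    · intro g _; rfl
  refine Eq.trans ?_ hR.symm
  rw [Finset.prod_univ_sum]
  rw [← Finset.sum_fiberwise_of_maps_to (s := B) (t := B) (g := Hmap e)]
  · apply Finset.sum_congr rfl
    intro g hg
    simp only [hB, Fintype.mem_piFinset, Finset.mem_range] at hg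
    simp only [f]
    split_ifs with hgL
    · have : ∀ i, (if i ∈ nSD e g then a i (g i)
            else ∑ m ∈ Finset.range (g i + 1), a i m) =
          ∑ m ∈ (if i ∈ nSD e g then {g i} else Finset.range (g i + 1)), a i m := by
        intro i; split_ifs <;> simp
      simp only [this]
      rw [Finset.prod_univ_sum]
      apply Finset.sum_congr _ (fun _ _ => rfl)
      ext M
      simp only [hB, Finset.mem_filter, Fintype.mem_piFinset, Finset.mem_range, Hmap_eq_iff hE hgL]
      constructor
      · rintro ⟨-, h⟩ i
        have := h i
        split_ifs at this ⊢
        · simpa using this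
        · simp; omega
      · intro h
        have h' : ∀ i, if i ∈ nSD e g then M i = g i else M i ≤ g i := by
          intro i
          have := h i
          split_ifs at this ⊢
          · simpa using this
          · simp at this; omega
        refine ⟨fun i => ?_, h'⟩
        have h1 := h' i
        have h2 := hg i
        split_ifs at h1 <;> omega
    · rw [Finset.filter_false_of_mem, Finset.sum_empty]
      rintro M - rfl
      exact hgL (Hmap_mem hE M)
  · intro M hM
    simp only [hB, Fintype.mem_piFinset, Finset.mem_range] at hM ⊢
    intro i
    have := Hmap_le hE hL (fun j => Nat.lt_succ_iff.1 (hM j)) i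
    omega

lemma conv_tensor {n : ℕ} {d : Fin n → ℕ} (lam : (i : Fin n) → Fin (d i) → ℝ) (L : Fin n → ℕ)
    (F G : (i : Fin n) → (Fin (d i) → ℝ) → ℝ) (x : Xsp n d) :
    convX (dilR lam (fun i => (L i : ℝ)) (fun x => ∏ i, F i (x i)))
      (dilR lam (fun i => (L i : ℝ)) (fun x => ∏ i, G i (x i))) x =
    ∏ i, convB i (dilBlock lam i (-(L i : ℝ)) (F i)) (dilBlock lam i (-(L i : ℝ)) (G i)) (x i) := by
  have hd : ∀ (F : (i : Fin n) → (Fin (d i) → ℝ) → ℝ) (y : Xsp n d),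
      dilR lam (fun i => (L i : ℝ)) (fun x => ∏ i, F i (x i)) y =
      ∏ i, dilBlock lam i (-(L i : ℝ)) (F i) (y i) := by
    intro F y
    simp only [dilR, dilBlock, Finset.prod_mul_distrib, neg_mul, neg_neg]
    rw [Real.rpow_sum_of_pos (by norm_num)]
  simp only [convX, convB, hd, ← Finset.prod_mul_distrib]
  exact integral_fintype_prod_volume_eq_prod (fun i w => dilBlock lam i (-(L i : ℝ)) (F i) w *
    dilBlock lam i (-(L i : ℝ)) (G i) (x i - w))

/-- the multi-norm Calderón identity
`Φ_L^{(−L)} ∗ Φ̃_L^{(−L)} = Σ_{L'∈𝓛, L'≤L} Ψ_{L'}^{(−L')} ∗ Ψ̃_{L'}^{(−L')}`. -/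
theorem stmt11 {n : ℕ} {d : Fin n → ℕ}
    (lam : (i : Fin n) → Fin (d i) → ℝ) (hlam : ∀ i h, 0 < lam i h)
    (e : Fin n → Fin n → ℝ) (hE : IsStandard e)
    (φ φt ψt : (i : Fin n) → ℕ → SchwartzMap (Fin (d i) → ℝ) ℝ)
    (hCald : ∀ (i : Fin n) (ℓ : ℕ), ∀ z : Fin (d i) → ℝ,
      convB i (dilBlock lam i (-(ℓ : ℝ)) ⇑(φ i ℓ))
        (dilBlock lam i (-(ℓ : ℝ)) ⇑(φt i ℓ)) z =
      ∑ ℓ' ∈ Finset.range (ℓ + 1),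
        convB i (dilBlock lam i (-(ℓ' : ℝ)) (psiF lam φ i ℓ'))
          (dilBlock lam i (-(ℓ' : ℝ)) ⇑(ψt i ℓ')) z) :
    ∀ L : Fin n → ℕ, L ∈ LLall e → ∀ x : Xsp n d,
      convX (dilR lam (fun i => (L i : ℝ)) (PhiT φ L))
        (dilR lam (fun i => (L i : ℝ)) (PhiT φt L)) x =
      ∑ g : (i : Fin n) → Fin (L i + 1),
        (if (fun i => (g i : ℕ)) ∈ LLall e then
          convX (dilR lam (fun i => ((g i : ℕ) : ℝ)) (PsiT e lam φ (fun i => (g i : ℕ))))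
            (dilR lam (fun i => ((g i : ℕ) : ℝ)) (PsiTl e ψt φt (fun i => (g i : ℕ)))) x
        else 0) := by
  intro L hL x
  have h1 := conv_tensor lam L (fun i => ⇑(φ i (L i))) (fun i => ⇑(φt i (L i))) x
  refine h1.trans ?_
  simp only [hCald]
  refine (comb hE hL (fun i m => convB i (dilBlock lam i (-(m : ℝ)) (psiF lam φ i m))
          (dilBlock lam i (-(m : ℝ)) ⇑(ψt i m)) (x i))).trans ?_
  apply Finset.sum_congr rfl
  intro g _
  split_ifs with hg
  · have h2 := conv_tensor lam (fun i => (g i : ℕ))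
      (fun i => if i ∈ DLof e (fun i => (g i : ℕ)) then psiF lam φ i (g i) else ⇑(φ i (g i)))
      (fun i => if i ∈ DLof e (fun i => (g i : ℕ)) then ⇑(ψt i (g i)) else ⇑(φt i (g i))) x
    have e1 : PsiT e lam φ (fun i => (g i : ℕ)) = fun x => ∏ i,
        (if i ∈ DLof e (fun i => (g i : ℕ)) then psiF lam φ i (g i) else ⇑(φ i (g i))) (x i) := by
      funext y
      simp only [PsiT]
      apply Finset.prod_congr rfl
      intro i _
      split_ifs <;> rfl
    have e2 : PsiTl e ψt φt (fun i => (g i : ℕ)) = fun x => ∏ i,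
        (if i ∈ DLof e (fun i => (g i : ℕ)) then ⇑(ψt i (g i)) else ⇑(φt i (g i))) (x i) := by
      funext y
      simp only [PsiTl]
      apply Finset.prod_congr rfl
      intro i _
      split_ifs <;> rfl
    rw [e1, e2, h2, DLof_eq hE]
    apply Finset.prod_congr rfl
    intro i _
    split_ifs
    · rfl
    · exact (hCald i (g i) (x i)).symm
  · rfl

end
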